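/- For all nonempty words x, y, z over V, the operations ∧ and ∨ satisfy the dendriform axioms (the vertical dendriform structure): (x∧y)∧z = x∧(y⧢z), (x∨y)∧z = x∨(y∧z), and (x⧢y)∨z = x∨(y∨z). -/

import Mathlib

open Finset MonoidAlgebra TensorProduct

/-- `Sh(p,q)`: permutations of the `p+q` indices that are increasing on the
first `p` indices and on the last `q` indices. -/
def IsSh (p q : ℕ) (σ : Equiv.Perm (Fin (p + q))) : Prop :=
  (∀ i j : Fin (p + q), (i : ℕ) < (j : ℕ) → (j : ℕ) < p → σ i < σ j) ∧
  (∀ i j : Fin (p + q), p ≤ (i : ℕ) → (i : ℕ) < (j : ℕ) → σ i < σ j)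

instance IsSh.decPred (p q : ℕ) : DecidablePred (IsSh p q) := fun _ => by
  unfold IsSh; infer_instance

/-- The word `u_{σ⁻¹(1)} u_{σ⁻¹(2)} ⋯ u_{σ⁻¹(p+q)}` where `u₁ ⋯ u_p` is `u` and
`u_{p+1} ⋯ u_{p+q}` is `v`. -/
def shWord {V : Type*} (u v : List V) (σ : Equiv.Perm (Fin (u.length + v.length))) :
    FreeMonoid V :=
  FreeMonoid.ofList
    (List.ofFn fun i => (u ++ v).get (Fin.cast (List.length_append (as := u) (bs := v)).symm (σ.symm i)))

/-- `posCond p b i` says that the letter at (combined) index `i` comes from the second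
word (`b = true`, i.e. `p ≤ i`) or from the first word (`b = false`, i.e. `i < p`). -/
def posCond (p : ℕ) (b : Bool) (i : ℕ) : Prop :=
  match b with
  | true => p ≤ i
  | false => i < p

instance posCond.dec (p : ℕ) (b : Bool) (i : ℕ) : Decidable (posCond p b i) := by
  cases b <;> unfold posCond <;> infer_instance

variable (k : Type*) [CommRing k] {V : Type*}

/-- The shuffle product `u ⧢ v` of two words, as an element of the monoid algebra
`H` of the free monoid on `V` (sum over all `(p,q)`-shuffles); in particular
`1 ⧢ a = a ⧢ 1 = a`. -/
noncomputable def shuffleProd (u v : List V) : MonoidAlgebra k (FreeMonoid V) :=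
  ∑ σ ∈ univ.filter (IsSh u.length v.length),
    MonoidAlgebra.single (shWord u v σ) (1 : k)

/-- Generic quadri-algebra operation on words: the part of the shuffle product `u ⧢ v`
consisting of the shuffles where the first (resp. last) letter comes from `v` iff `fb`
(resp. `lb`) is `true`.  (For a shuffle permutation, the first letter comes from `v`
iff `σ⁻¹(1) = p+1`, and from `u` iff `σ⁻¹(1) = 1`; the last letter comes from `v` iff
`σ⁻¹(p+q) = p+q`, and from `u` iff `σ⁻¹(p+q) = p`.)  This definition also encodes the
empty-word conventions: `1 ↘ a = a` and `a ↖ 1 = a` for nonempty `a`, and all other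
quadri-algebra operations with an empty argument are `0`. -/
noncomputable def quadOp (fb lb : Bool) (u v : List V) : MonoidAlgebra k (FreeMonoid V) :=
  ∑ σ ∈ univ.filter (fun σ : Equiv.Perm (Fin (u.length + v.length)) =>
      IsSh u.length v.length σ ∧
      ∃ h : 0 < u.length + v.length,
        posCond u.length fb (σ.symm ⟨0, h⟩) ∧
        posCond u.length lb (σ.symm ⟨u.length + v.length - 1, Nat.sub_lt h Nat.one_pos⟩)),
    MonoidAlgebra.single (shWord u v σ) (1 : k)

/-- `u ↘ v` : shuffles whose first and last letters come from `v`. -/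
noncomputable def seOp (u v : List V) : MonoidAlgebra k (FreeMonoid V) := quadOp k true true u v

/-- `u ↗ v` : shuffles whose first letter comes from `v` and last letter from `u`. -/
noncomputable def neOp (u v : List V) : MonoidAlgebra k (FreeMonoid V) := quadOp k true false u v

/-- `u ↖ v` : shuffles whose first and last letters come from `u`. -/
noncomputable def nwOp (u v : List V) : MonoidAlgebra k (FreeMonoid V) := quadOp k false false u v

/-- `u ↙ v` : shuffles whose first letter comes from `u` and last letter from `v`. -/
noncomputable def swOp (u v : List V) : MonoidAlgebra k (FreeMonoid V) := quadOp k false true u v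

/-- `u ≻ v := u ↗ v + u ↘ v`. -/
noncomputable def succOp (u v : List V) : MonoidAlgebra k (FreeMonoid V) := neOp k u v + seOp k u v

/-- `u ≺ v := u ↖ v + u ↙ v`. -/
noncomputable def precOp (u v : List V) : MonoidAlgebra k (FreeMonoid V) := nwOp k u v + swOp k u v

/-- `u ∨ v := u ↘ v + u ↙ v`. -/
noncomputable def veeOp (u v : List V) : MonoidAlgebra k (FreeMonoid V) := seOp k u v + swOp k u v

/-- `u ∧ v := u ↗ v + u ↖ v`. -/
noncomputable def wedgeOp (u v : List V) : MonoidAlgebra k (FreeMonoid V) := neOp k u v + nwOp k u v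

/-- `x ⋆ y := x ↗ y + x ↘ y + x ↖ y + x ↙ y`. -/
noncomputable def starOp (u v : List V) : MonoidAlgebra k (FreeMonoid V) :=
  neOp k u v + seOp k u v + nwOp k u v + swOp k u v

/-- The word `u`, viewed as an element of the monoid algebra. -/
noncomputable def wordElt (u : List V) : MonoidAlgebra k (FreeMonoid V) :=
  MonoidAlgebra.single (FreeMonoid.ofList u) (1 : k)

/-- `k`-bilinear extension of a word-level operation to the monoid algebra. -/
noncomputable def liftB (f : FreeMonoid V → FreeMonoid V → MonoidAlgebra k (FreeMonoid V))
    (x y : MonoidAlgebra k (FreeMonoid V)) : MonoidAlgebra k (FreeMonoid V) :=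
  Finsupp.sum x.coeff fun a ca => Finsupp.sum y.coeff fun b cb => (ca * cb) • f a b

/-- `↘`, extended `k`-bilinearly to the monoid algebra. -/
noncomputable def seH : MonoidAlgebra k (FreeMonoid V) → MonoidAlgebra k (FreeMonoid V) →
    MonoidAlgebra k (FreeMonoid V) :=
  liftB k fun a b => seOp k (FreeMonoid.toList a) (FreeMonoid.toList b)

/-- `↗`, extended `k`-bilinearly to the monoid algebra. -/
noncomputable def neH : MonoidAlgebra k (FreeMonoid V) → MonoidAlgebra k (FreeMonoid V) →
    MonoidAlgebra k (FreeMonoid V) :=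
  liftB k fun a b => neOp k (FreeMonoid.toList a) (FreeMonoid.toList b)

/-- `↖`, extended `k`-bilinearly to the monoid algebra. -/
noncomputable def nwH : MonoidAlgebra k (FreeMonoid V) → MonoidAlgebra k (FreeMonoid V) →
    MonoidAlgebra k (FreeMonoid V) :=
  liftB k fun a b => nwOp k (FreeMonoid.toList a) (FreeMonoid.toList b)

/-- `↙`, extended `k`-bilinearly to the monoid algebra. -/
noncomputable def swH : MonoidAlgebra k (FreeMonoid V) → MonoidAlgebra k (FreeMonoid V) →
    MonoidAlgebra k (FreeMonoid V) :=
  liftB k fun a b => swOp k (FreeMonoid.toList a) (FreeMonoid.toList b)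

/-- `≻ = ↗ + ↘` on the monoid algebra. -/
noncomputable def succH (x y : MonoidAlgebra k (FreeMonoid V)) : MonoidAlgebra k (FreeMonoid V) :=
  neH k x y + seH k x y

/-- `≺ = ↖ + ↙` on the monoid algebra. -/
noncomputable def precH (x y : MonoidAlgebra k (FreeMonoid V)) : MonoidAlgebra k (FreeMonoid V) :=
  nwH k x y + swH k x y

/-- `∨ = ↘ + ↙` on the monoid algebra. -/
noncomputable def veeH (x y : MonoidAlgebra k (FreeMonoid V)) : MonoidAlgebra k (FreeMonoid V) :=
  seH k x y + swH k x y

/-- `∧ = ↗ + ↖` on the monoid algebra. -/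
noncomputable def wedgeH (x y : MonoidAlgebra k (FreeMonoid V)) : MonoidAlgebra k (FreeMonoid V) :=
  neH k x y + nwH k x y

section Aux

/-- Uniform form of the shuffle condition. -/
def Sh1 (n p : ℕ) (σ : Equiv.Perm (Fin n)) : Prop :=
  ∀ i j : Fin n, i < j → ((j : ℕ) < p ∨ p ≤ (i : ℕ)) → σ i < σ j

theorem isSh_iff (p q : ℕ) (σ : Equiv.Perm (Fin (p + q))) : IsSh p q σ ↔ Sh1 (p + q) p σ := by
  constructor
  · rintro ⟨h1, h2⟩ i j hij (h | h)
    · exact h1 i j hij h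
    · exact h2 i j h hij
  · intro h
    exact ⟨fun i j hij hj => h i j hij (Or.inl hj), fun i j hi hij => h i j hij (Or.inr hi)⟩

/-- Extend a permutation by sending `j` to the last index. -/
def extPerm {n : ℕ} (j : Fin (n + 1)) (τ : Equiv.Perm (Fin n)) : Equiv.Perm (Fin (n + 1)) :=
  ((finSuccEquiv' j).trans (Equiv.optionCongr τ)).trans (finSuccEquiv' (Fin.last n)).symm

theorem extPerm_self {n : ℕ} (j : Fin (n + 1)) (τ : Equiv.Perm (Fin n)) :
    extPerm j τ j = Fin.last n := by
  simp [extPerm]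

theorem extPerm_succAbove {n : ℕ} (j : Fin (n + 1)) (τ : Equiv.Perm (Fin n)) (i : Fin n) :
    extPerm j τ (j.succAbove i) = (τ i).castSucc := by
  simp [extPerm]

theorem extPerm_symm_last {n : ℕ} (j : Fin (n + 1)) (τ : Equiv.Perm (Fin n)) :
    (extPerm j τ).symm (Fin.last n) = j := by
  rw [Equiv.symm_apply_eq, extPerm_self]

theorem extPerm_symm_castSucc {n : ℕ} (j : Fin (n + 1)) (τ : Equiv.Perm (Fin n)) (i : Fin n) :
    (extPerm j τ).symm i.castSucc = j.succAbove (τ.symm i) := by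
  rw [Equiv.symm_apply_eq, extPerm_succAbove, Equiv.apply_symm_apply]

theorem extPerm_inj {n : ℕ} (j : Fin (n + 1)) : Function.Injective (extPerm j) := by
  intro τ τ' h
  ext i
  have := congrArg (fun e => e (j.succAbove i)) h
  simp only [extPerm_succAbove] at this
  exact congrArg Fin.val (Fin.castSucc_injective _ this)

theorem extPerm_surj {n : ℕ} (j : Fin (n + 1)) (σ : Equiv.Perm (Fin (n + 1)))
    (h : σ j = Fin.last n) : ∃ τ, extPerm j τ = σ := by
  have key : ∀ i, σ (j.succAbove i) ≠ Fin.last n := fun i hi =>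
    Fin.succAbove_ne j i (σ.injective (hi.trans h.symm))
  let f : Fin n → Fin n := fun i => (σ (j.succAbove i)).castPred (key i)
  have hf : Function.Injective f := by
    intro a b hab
    simpa [f] using hab
  refine ⟨Equiv.ofBijective f (Finite.injective_iff_bijective.mp hf), ?_⟩
  apply Equiv.ext
  intro i
  rcases Fin.eq_self_or_eq_succAbove j i with rfl | ⟨i, rfl⟩
  · rw [extPerm_self, h]
  · rw [extPerm_succAbove]; simp [f]

theorem sh1_ext {n p p' : ℕ} (j : Fin (n + 1))
    (hj : ((j : ℕ) = p' ∧ p = p' + 1) ∨ ((j : ℕ) = n ∧ p = p' ∧ p ≤ n))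
    (τ : Equiv.Perm (Fin n)) : Sh1 (n + 1) p (extPerm j τ) ↔ Sh1 n p' τ := by
  constructor
  · intro h a b hab hc
    have := h (j.succAbove a) (j.succAbove b) (Fin.strictMono_succAbove j hab) (by
      have := a.2; have := b.2
      simp only [Fin.succAbove, Fin.lt_def, Fin.val_castSucc] at *
      split_ifs <;> simp <;> omega)
    rw [extPerm_succAbove, extPerm_succAbove] at this
    exact this
  · intro h a b hab hc
    rcases Fin.eq_self_or_eq_succAbove j a with rfl | ⟨a, rfl⟩
    · exfalso
      have := b.2
      simp only [Fin.lt_def] at hab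
      omega
    · rcases Fin.eq_self_or_eq_succAbove j b with rfl | ⟨b, rfl⟩
      · rw [extPerm_self, extPerm_succAbove]; exact Fin.castSucc_lt_last _
      · rw [extPerm_succAbove, extPerm_succAbove]
        have hab' : a < b := (Fin.strictMono_succAbove j).lt_iff_lt.mp hab
        refine h a b hab' ?_
        have := a.2; have := b.2
        simp only [Fin.succAbove, Fin.lt_def, Fin.val_castSucc] at *
        split_ifs at hc <;> simp at hc <;> omega

open Classical in
theorem core {n p p' : ℕ} (j : Fin (n + 1))
    (hj : ((j : ℕ) = p' ∧ p = p' + 1) ∨ ((j : ℕ) = n ∧ p = p' ∧ p ≤ n)) (f : Fin (n + 1) → V) :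
    ∑ σ ∈ univ.filter (fun σ : Equiv.Perm (Fin (n + 1)) => Sh1 (n + 1) p σ ∧ σ j = Fin.last n),
      (MonoidAlgebra.single (FreeMonoid.ofList (List.ofFn fun i => f (σ.symm i))) 1 :
        MonoidAlgebra k (FreeMonoid V)) =
    (∑ τ ∈ univ.filter (fun τ : Equiv.Perm (Fin n) => Sh1 n p' τ),
      MonoidAlgebra.single (FreeMonoid.ofList (List.ofFn fun i => f (j.succAbove (τ.symm i)))) 1) *
      MonoidAlgebra.single (FreeMonoid.ofList [f j]) 1 := by
  rw [Finset.sum_mul]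
  symm
  refine Finset.sum_bij (fun τ _ => extPerm j τ) ?_ ?_ ?_ ?_
  · intro τ hτ
    simp only [mem_filter, mem_univ, true_and] at hτ ⊢
    exact ⟨(sh1_ext j hj τ).2 hτ, extPerm_self j τ⟩
  · intro a _ b _ h
    exact extPerm_inj j h
  · intro σ hσ
    simp only [mem_filter, mem_univ, true_and] at hσ
    obtain ⟨τ, rfl⟩ := extPerm_surj j σ hσ.2
    exact ⟨τ, by simpa using (sh1_ext j hj τ).1 hσ.1, rfl⟩
  · intro τ _
    rw [MonoidAlgebra.single_mul_single, one_mul, ← FreeMonoid.ofList_append]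
    congr 2
    rw [List.ofFn_succ_last, extPerm_symm_last]
    simp only [extPerm_symm_castSucc]

/-- Sum over shuffles with a condition on the origin of the last letter. -/
theorem wedge_eq (u v : List V) : wedgeOp k u v =
    ∑ σ ∈ univ.filter (fun σ : Equiv.Perm (Fin (u.length + v.length)) =>
      IsSh u.length v.length σ ∧
      ∃ h : 0 < u.length + v.length, 
        posCond u.length false (σ.symm ⟨u.length + v.length - 1, Nat.sub_lt h Nat.one_pos⟩)),
    MonoidAlgebra.single (shWord u v σ) (1 : k) := by
  unfold wedgeOp neOp nwOp quadOp
  rw [← Finset.sum_union]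
  · apply Finset.sum_congr _ (fun _ _ => rfl)
    ext σ
    simp only [mem_union, mem_filter, mem_univ, true_and]
    simp only [posCond]
    constructor
    · rintro (⟨h1, h2, h3, h4⟩ | ⟨h1, h2, h3, h4⟩)
      · exact ⟨h1, h2, h4⟩
      · exact ⟨h1, h2, h4⟩
    · rintro ⟨h1, h2, h4⟩
      rcases le_or_gt u.length (σ.symm ⟨0, h2⟩ : ℕ) with h | h
      · exact Or.inl ⟨h1, h2, h, h4⟩
      · exact Or.inr ⟨h1, h2, h, h4⟩
  · rw [Finset.disjoint_left]
    intro σ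
    simp only [mem_filter, mem_univ, true_and]
    simp only [posCond]
    rintro ⟨_, _, h, _⟩ ⟨_, _, h', _⟩
    omega

theorem vee_eq (u v : List V) : veeOp k u v =
    ∑ σ ∈ univ.filter (fun σ : Equiv.Perm (Fin (u.length + v.length)) =>
      IsSh u.length v.length σ ∧
      ∃ h : 0 < u.length + v.length, 
        posCond u.length true (σ.symm ⟨u.length + v.length - 1, Nat.sub_lt h Nat.one_pos⟩)),
    MonoidAlgebra.single (shWord u v σ) (1 : k) := by
  unfold veeOp seOp swOp quadOp
  rw [← Finset.sum_union]
  · apply Finset.sum_congr _ (fun _ _ => rfl)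
    ext σ
    simp only [mem_union, mem_filter, mem_univ, true_and]
    simp only [posCond]
    constructor
    · rintro (⟨h1, h2, h3, h4⟩ | ⟨h1, h2, h3, h4⟩)
      · exact ⟨h1, h2, h4⟩
      · exact ⟨h1, h2, h4⟩
    · rintro ⟨h1, h2, h4⟩
      rcases le_or_gt u.length (σ.symm ⟨0, h2⟩ : ℕ) with h | h
      · exact Or.inl ⟨h1, h2, h, h4⟩
      · exact Or.inr ⟨h1, h2, h, h4⟩
  · rw [Finset.disjoint_left]
    intro σ
    simp only [mem_filter, mem_univ, true_and]
    simp only [posCond]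
    rintro ⟨_, _, h, _⟩ ⟨_, _, h', _⟩
    omega

theorem shuffle_split (u v : List V) (h : 0 < u.length + v.length) :
    shuffleProd k u v = wedgeOp k u v + veeOp k u v := by
  rw [wedge_eq, vee_eq, ← Finset.sum_union]
  · apply Finset.sum_congr _ (fun _ _ => rfl)
    ext σ
    simp only [mem_union, mem_filter, mem_univ, true_and]
    simp only [posCond]
    constructor
    · intro h1
      rcases le_or_gt u.length
        (σ.symm ⟨u.length + v.length - 1, Nat.sub_lt h Nat.one_pos⟩ : ℕ) with h' | h'
      · exact Or.inr ⟨h1, h, h'⟩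
      · exact Or.inl ⟨h1, h, h'⟩
    · rintro (h1 | h1)
      · exact h1.1
      · exact h1.1
  · rw [Finset.disjoint_left]
    intro σ
    simp only [mem_filter, mem_univ, true_and]
    simp only [posCond]
    rintro ⟨_, _, h⟩ ⟨_, _, h'⟩
    omega

theorem shuffle_nil_nil : shuffleProd k ([] : List V) [] = wordElt k [] := by
  unfold shuffleProd wordElt
  have : (univ.filter (IsSh ([] : List V).length ([] : List V).length)) = {1} := by
    ext σ
    simp only [mem_filter, mem_univ, true_and, mem_singleton]
    constructor
    · intro _; apply Equiv.ext; intro i; exact absurd i.2 (by simp)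
    · rintro rfl; exact ⟨fun i => absurd i.2 (by simp), fun i => absurd i.2 (by simp)⟩
  rw [this, Finset.sum_singleton]
  rfl

theorem wedge_nil (v : List V) : wedgeOp k [] v = 0 := by
  rw [wedge_eq]
  apply Finset.sum_eq_zero
  intro σ h
  simp [posCond] at h

theorem vee_nil (u : List V) : veeOp k u [] = 0 := by
  rw [vee_eq]
  apply Finset.sum_eq_zero
  intro σ h
  simp only [mem_filter, mem_univ, true_and] at h
  simp only [posCond] at h
  obtain ⟨_, h0, h1⟩ := h
  have := (σ.symm ⟨u.length + ([] : List V).length - 1, Nat.sub_lt h0 Nat.one_pos⟩).2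
  simp only [List.length_nil] at *
  omega

open Classical in
theorem shuffle_gen (u v : List V) (n : ℕ) (h : n = u.length + v.length) :
    shuffleProd k u v = ∑ σ ∈ univ.filter (fun σ : Equiv.Perm (Fin n) => Sh1 n u.length σ),
      MonoidAlgebra.single (FreeMonoid.ofList (List.ofFn fun i =>
        (u ++ v)[(σ.symm i : ℕ)]'(by rw [List.length_append, ← h]; exact (σ.symm i).2))) 1 := by
  subst h
  unfold shuffleProd
  apply Finset.sum_congr
  · ext σ; simp [isSh_iff]
  · intro σ _; rfl

open Classical in
theorem wedge_gen (u v : List V) (n : ℕ) (h : n + 1 = u.length + v.length) :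
    wedgeOp k u v = ∑ σ ∈ univ.filter (fun σ : Equiv.Perm (Fin (n + 1)) =>
      Sh1 (n + 1) u.length σ ∧ (σ.symm (Fin.last n) : ℕ) < u.length),
      MonoidAlgebra.single (FreeMonoid.ofList (List.ofFn fun i =>
        (u ++ v)[(σ.symm i : ℕ)]'(by rw [List.length_append, ← h]; exact (σ.symm i).2))) 1 := by
  rw [wedge_eq]
  have : ∀ m (hm : m = u.length + v.length) (h0 : 0 < m),
    (∑ σ ∈ univ.filter (fun σ : Equiv.Perm (Fin (u.length + v.length)) =>
      IsSh u.length v.length σ ∧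
      ∃ h : 0 < u.length + v.length, 
        posCond u.length false (σ.symm ⟨u.length + v.length - 1, Nat.sub_lt h Nat.one_pos⟩)),
      MonoidAlgebra.single (shWord u v σ) (1 : k)) =
    ∑ σ ∈ univ.filter (fun σ : Equiv.Perm (Fin m) =>
      Sh1 m u.length σ ∧ (σ.symm ⟨m - 1, Nat.sub_lt h0 Nat.one_pos⟩ : ℕ) < u.length),
      MonoidAlgebra.single (FreeMonoid.ofList (List.ofFn fun i =>
        (u ++ v)[(σ.symm i : ℕ)]'(by rw [List.length_append, ← hm]; exact (σ.symm i).2))) 1 := by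
    intro m hm h0
    subst hm
    apply Finset.sum_congr
    · ext σ
      simp only [mem_filter, mem_univ, true_and, posCond, isSh_iff]
      exact and_congr_right fun _ => ⟨fun ⟨_, h⟩ => h, fun h => ⟨h0, h⟩⟩
    · intro σ _; rfl
  exact this (n + 1) h (Nat.succ_pos n)

open Classical in
theorem vee_gen (u v : List V) (n : ℕ) (h : n + 1 = u.length + v.length) :
    veeOp k u v = ∑ σ ∈ univ.filter (fun σ : Equiv.Perm (Fin (n + 1)) =>
      Sh1 (n + 1) u.length σ ∧ u.length ≤ (σ.symm (Fin.last n) : ℕ)),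
      MonoidAlgebra.single (FreeMonoid.ofList (List.ofFn fun i =>
        (u ++ v)[(σ.symm i : ℕ)]'(by rw [List.length_append, ← h]; exact (σ.symm i).2))) 1 := by
  rw [vee_eq]
  have : ∀ m (hm : m = u.length + v.length) (h0 : 0 < m),
    (∑ σ ∈ univ.filter (fun σ : Equiv.Perm (Fin (u.length + v.length)) =>
      IsSh u.length v.length σ ∧
      ∃ h : 0 < u.length + v.length, 
        posCond u.length true (σ.symm ⟨u.length + v.length - 1, Nat.sub_lt h Nat.one_pos⟩)),
      MonoidAlgebra.single (shWord u v σ) (1 : k)) =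
    ∑ σ ∈ univ.filter (fun σ : Equiv.Perm (Fin m) =>
      Sh1 m u.length σ ∧ u.length ≤ (σ.symm ⟨m - 1, Nat.sub_lt h0 Nat.one_pos⟩ : ℕ)),
      MonoidAlgebra.single (FreeMonoid.ofList (List.ofFn fun i =>
        (u ++ v)[(σ.symm i : ℕ)]'(by rw [List.length_append, ← hm]; exact (σ.symm i).2))) 1 := by
    intro m hm h0
    subst hm
    apply Finset.sum_congr
    · ext σ
      simp only [mem_filter, mem_univ, true_and, posCond, isSh_iff]
      exact and_congr_right fun _ => ⟨fun ⟨_, h⟩ => h, fun h => ⟨h0, h⟩⟩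
    · intro σ _; rfl
  exact this (n + 1) h (Nat.succ_pos n)

theorem wedge_snoc (u v : List V) (a : V) :
    wedgeOp k (u ++ [a]) v = shuffleProd k u v * wordElt k [a] := by
  classical
  have hlen : u.length + v.length + 1 = (u ++ [a]).length + v.length := by simp; omega
  rw [wedge_gen k (u ++ [a]) v (u.length + v.length) hlen,
    shuffle_gen k u v (u.length + v.length) rfl]
  let j : Fin (u.length + v.length + 1) := ⟨u.length, by omega⟩
  have hc := core k (p := u.length + 1) (p' := u.length) j (Or.inl ⟨rfl, rfl⟩)
    (fun i => ((u ++ [a]) ++ v)[(i : ℕ)]'(by rw [List.length_append, ← hlen]; exact i.2))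
  have hja : ((u ++ [a]) ++ v)[(j : ℕ)]'(by rw [List.length_append, ← hlen]; exact j.2) = a := by
    simp [j]
  rw [hja] at hc
  refine Eq.trans (Finset.sum_congr ?_ fun _ _ => rfl)
    (hc.trans (congrArg₂ _ (Finset.sum_congr rfl ?_) rfl))
  · ext σ
    simp only [mem_filter, mem_univ, true_and, List.length_append, List.length_singleton]
    refine and_congr_right fun hs => ?_
    rw [← Equiv.eq_symm_apply]
    constructor
    · intro h
      by_contra hne
      have hlt : σ.symm (Fin.last _) < j := by
        rw [Fin.lt_def]
        have : (σ.symm (Fin.last (u.length + v.length)) : ℕ) ≠ u.length :=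
          fun e => hne (Fin.ext e.symm)
        change _ < u.length
        omega
      have := hs _ _ hlt (Or.inl (Nat.lt_succ_self _))
      rw [Equiv.apply_symm_apply] at this
      exact absurd this (not_lt.mpr (Fin.le_last _))
    · intro h
      rw [← h]; exact Nat.lt_succ_self _
  · intro τ _
    congr 3
    funext i
    generalize τ.symm i = m
    have := m.2
    simp only [j, Fin.succAbove, Fin.lt_def, Fin.val_castSucc]
    split_ifs with hm
    · simp [hm]
    · simp only [Fin.val_succ, List.getElem_append, List.length_append, List.length_singleton]
      rw [dif_neg (by omega), dif_neg (by omega)]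
      congr 1
      omega

theorem vee_snoc (u v : List V) (b : V) :
    veeOp k u (v ++ [b]) = shuffleProd k u v * wordElt k [b] := by
  classical
  have hlen : u.length + v.length + 1 = u.length + (v ++ [b]).length := by simp; omega
  rw [vee_gen k u (v ++ [b]) (u.length + v.length) hlen,
    shuffle_gen k u v (u.length + v.length) rfl]
  let j : Fin (u.length + v.length + 1) := Fin.last _
  have hc := core k (p := u.length) (p' := u.length) j (Or.inr ⟨rfl, rfl, by omega⟩)
    (fun i => (u ++ (v ++ [b]))[(i : ℕ)]'(by rw [List.length_append, ← hlen]; exact i.2))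
  have hja : (u ++ (v ++ [b]))[(j : ℕ)]'(by rw [List.length_append, ← hlen]; exact j.2) = b := by
    simp [j]
  rw [hja] at hc
  refine Eq.trans (Finset.sum_congr ?_ fun _ _ => rfl)
    (hc.trans (congrArg₂ _ (Finset.sum_congr rfl ?_) rfl))
  · ext σ
    simp only [mem_filter, mem_univ, true_and]
    refine and_congr_right fun hs => ?_
    rw [← Equiv.eq_symm_apply]
    constructor
    · intro h
      by_contra hne
      have hlt : σ.symm (Fin.last _) < j := lt_of_le_of_ne (Fin.le_last _) (Ne.symm hne)
      have := hs _ _ hlt (Or.inr h)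
      rw [Equiv.apply_symm_apply] at this
      exact absurd this (not_lt.mpr (Fin.le_last _))
    · intro h
      rw [← h]; simp [j]
  · intro τ _
    congr 3
    funext i
    generalize τ.symm i = m
    have := m.2
    simp only [j, Fin.succAbove_last, Fin.val_castSucc, ← List.append_assoc]
    rw [List.getElem_append_left]

theorem shuffle_nil_left (v : List V) : shuffleProd k [] v = wordElt k v := by
  induction v using List.reverseRecOn with
  | nil => exact shuffle_nil_nil k
  | append_singleton v b ih =>
    rw [shuffle_split k _ _ (by simp), wedge_nil, vee_snoc, ih, zero_add]
    simp [wordElt, MonoidAlgebra.single_mul_single]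

theorem shuffle_nil_right (u : List V) : shuffleProd k u [] = wordElt k u := by
  induction u using List.reverseRecOn with
  | nil => exact shuffle_nil_nil k
  | append_singleton v b ih =>
    rw [shuffle_split k _ _ (by simp), vee_nil, wedge_snoc, ih, add_zero]
    simp [wordElt, MonoidAlgebra.single_mul_single]

theorem shuffle_snoc (u v : List V) (a b : V) : shuffleProd k (u ++ [a]) (v ++ [b]) =
    shuffleProd k u (v ++ [b]) * wordElt k [a] + shuffleProd k (u ++ [a]) v * wordElt k [b] := by
  rw [shuffle_split k _ _ (by simp), wedge_snoc, vee_snoc]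

/-- `liftB` as a bilinear map. -/
noncomputable def liftL (f : FreeMonoid V → FreeMonoid V → MonoidAlgebra k (FreeMonoid V)) :
    MonoidAlgebra k (FreeMonoid V) →ₗ[k] MonoidAlgebra k (FreeMonoid V) →ₗ[k]
      MonoidAlgebra k (FreeMonoid V) :=
  LinearMap.mk₂ k (liftB k f)
    (by
      intro x x' y
      unfold liftB
      rw [MonoidAlgebra.coeff_add, Finsupp.sum_add_index']
      · intro a; simp
      · intro a c c'; rw [← Finsupp.sum_add]; simp only [add_mul, add_smul])
    (by
      intro c x y
      unfold liftB
      rw [MonoidAlgebra.coeff_smul, Finsupp.sum_smul_index' (by intro a; simp), Finsupp.smul_sum]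
      simp only [Finsupp.smul_sum, smul_smul, smul_eq_mul, mul_assoc])
    (by
      intro x y y'
      unfold liftB
      rw [← Finsupp.sum_add]
      congr 1
      funext a c
      rw [MonoidAlgebra.coeff_add, Finsupp.sum_add_index']
      · intro a; simp
      · intro b c c'; rw [mul_add, add_smul])
    (by
      intro c x y
      unfold liftB
      rw [Finsupp.smul_sum]
      congr 1
      funext a d
      rw [MonoidAlgebra.coeff_smul, Finsupp.sum_smul_index' (by intro a; simp), Finsupp.smul_sum]
      simp only [smul_smul, smul_eq_mul, mul_left_comm])

theorem liftL_apply (f : FreeMonoid V → FreeMonoid V → MonoidAlgebra k (FreeMonoid V))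
    (x y : MonoidAlgebra k (FreeMonoid V)) : liftL k f x y = liftB k f x y := rfl

theorem liftL_word (f : FreeMonoid V → FreeMonoid V → MonoidAlgebra k (FreeMonoid V))
    (u v : List V) : liftL k f (wordElt k u) (wordElt k v) =
      f (FreeMonoid.ofList u) (FreeMonoid.ofList v) := by
  rw [liftL_apply]
  simp [liftB, wordElt]

theorem word_ind {P : MonoidAlgebra k (FreeMonoid V) → Prop} (hw : ∀ u, P (wordElt k u))
    (h0 : P 0) (ha : ∀ x y, P x → P y → P (x + y)) (hs : ∀ (c : k) x, P x → P (c • x))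
    (x : MonoidAlgebra k (FreeMonoid V)) : P x := by
  induction x using MonoidAlgebra.induction_linear with
  | zero => exact h0
  | add x y hx hy => exact ha x y hx hy
  | single m r =>
    have := hs r _ (hw (FreeMonoid.toList m))
    simpa [wordElt] using this

/-- bilinear shuffle -/
noncomputable def SL := liftL (V := V) k fun a b => shuffleProd k a.toList b.toList
/-- bilinear wedge -/
noncomputable def WL := liftL (V := V) k fun a b => wedgeOp k a.toList b.toList
/-- bilinear vee -/
noncomputable def EL := liftL (V := V) k fun a b => veeOp k a.toList b.toList

theorem SL_word (u v : List V) : SL k (wordElt k u) (wordElt k v) = shuffleProd k u v := by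
  rw [SL, liftL_word]; rfl
theorem WL_word (u v : List V) : WL k (wordElt k u) (wordElt k v) = wedgeOp k u v := by
  rw [WL, liftL_word]; rfl
theorem EL_word (u v : List V) : EL k (wordElt k u) (wordElt k v) = veeOp k u v := by
  rw [EL, liftL_word]; rfl

theorem wedgeH_eq (x y : MonoidAlgebra k (FreeMonoid V)) : wedgeH k x y = WL k x y := by
  unfold wedgeH neH nwH WL
  rw [liftL_apply]
  simp only [liftB, wedgeOp, smul_add, Finsupp.sum_add]

theorem veeH_eq (x y : MonoidAlgebra k (FreeMonoid V)) : veeH k x y = EL k x y := by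
  unfold veeH seH swH EL
  rw [liftL_apply]
  simp only [liftB, veeOp, smul_add, Finsupp.sum_add]

theorem word_append (u v : List V) : wordElt k (u ++ v) = wordElt k u * wordElt k v := by
  simp [wordElt, MonoidAlgebra.single_mul_single]

theorem WL_mul (x y : MonoidAlgebra k (FreeMonoid V)) (a : V) :
    WL k (x * wordElt k [a]) y = SL k x y * wordElt k [a] := by
  induction x using word_ind k with
  | hw u =>
    induction y using word_ind k with
    | hw v => rw [← word_append, WL_word, SL_word, wedge_snoc]
    | h0 => simp
    | ha y y' h h' => simp only [map_add, h, h', add_mul]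
    | hs c y h => simp only [map_smul, h, smul_mul_assoc]
  | h0 => simp
  | ha y y' h h' => simp only [map_add, LinearMap.add_apply, h, h', add_mul]
  | hs c y h => simp only [map_smul, LinearMap.smul_apply, h, smul_mul_assoc]

theorem EL_mul (x y : MonoidAlgebra k (FreeMonoid V)) (a : V) :
    EL k x (y * wordElt k [a]) = SL k x y * wordElt k [a] := by
  induction x using word_ind k with
  | hw u =>
    induction y using word_ind k with
    | hw v => rw [← word_append, EL_word, SL_word, vee_snoc]
    | h0 => simp
    | ha y y' h h' => simp only [map_add, h, h', add_mul]
    | hs c y h => simp only [map_smul, h, smul_mul_assoc]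
  | h0 => simp
  | ha y y' h h' => simp only [map_add, LinearMap.add_apply, h, h', add_mul]
  | hs c y h => simp only [map_smul, LinearMap.smul_apply, h, smul_mul_assoc]

theorem SL_mul_mul (x y : MonoidAlgebra k (FreeMonoid V)) (a b : V) :
    SL k (x * wordElt k [a]) (y * wordElt k [b]) =
      SL k x (y * wordElt k [b]) * wordElt k [a] + SL k (x * wordElt k [a]) y * wordElt k [b] := by
  induction x using word_ind k with
  | hw u =>
    induction y using word_ind k with
    | hw v => simp only [← word_append, SL_word, shuffle_snoc]
    | h0 => simp
    | ha y y' h h' => simp only [map_add, h, h', add_mul]; abel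
    | hs c y h => simp only [map_smul, h, smul_mul_assoc, smul_add]
  | h0 => simp
  | ha y y' h h' => simp only [map_add, LinearMap.add_apply, h, h', add_mul]; abel
  | hs c y h => simp only [map_smul, LinearMap.smul_apply, h, smul_mul_assoc, smul_add]

theorem SL_one_left (x : MonoidAlgebra k (FreeMonoid V)) : SL k (wordElt k []) x = x := by
  induction x using word_ind k with
  | hw u => rw [SL_word, shuffle_nil_left]
  | h0 => simp
  | ha y y' h h' => simp only [map_add, h, h']
  | hs c y h => simp only [map_smul, h]

theorem SL_one_right (x : MonoidAlgebra k (FreeMonoid V)) : SL k x (wordElt k []) = x := by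
  induction x using word_ind k with
  | hw u => rw [SL_word, shuffle_nil_right]
  | h0 => simp
  | ha y y' h h' => simp only [map_add, LinearMap.add_apply, h, h']
  | hs c y h => simp only [map_smul, LinearMap.smul_apply, h]

theorem SL_assoc_word (n : ℕ) : ∀ (x y z : List V), x.length + y.length + z.length = n →
    SL k (SL k (wordElt k x) (wordElt k y)) (wordElt k z) =
      SL k (wordElt k x) (SL k (wordElt k y) (wordElt k z)) := by
  induction n with
  | zero =>
    intro x y z h
    obtain rfl : x = [] := List.eq_nil_of_length_eq_zero (by omega)
    rw [SL_one_left, SL_one_left]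
  | succ n ih =>
    intro x y z h
    rcases List.eq_nil_or_concat' x with rfl | ⟨x, a, rfl⟩
    · rw [SL_one_left, SL_one_left]
    rcases List.eq_nil_or_concat' y with rfl | ⟨y, b, rfl⟩
    · rw [SL_one_left, SL_one_right]
    rcases List.eq_nil_or_concat' z with rfl | ⟨z, c, rfl⟩
    · rw [SL_one_right, SL_one_right]
    simp only [List.length_append, List.length_singleton] at h
    have h1 := ih x (y ++ [b]) (z ++ [c]) (by simp; omega)
    have h2 := ih (x ++ [a]) y (z ++ [c]) (by simp; omega)
    have h3 := ih (x ++ [a]) (y ++ [b]) z (by simp; omega)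
    simp only [word_append] at h1 h2 h3 ⊢
    rw [SL_mul_mul k (wordElt k x), SL_mul_mul k (wordElt k y)] at *
    simp only [map_add, LinearMap.add_apply, SL_mul_mul] at h1 h2 h3 ⊢
    rw [h1, h2, ← h3]
    simp only [add_mul]
    abel

theorem SL_assoc (x y z : List V) :
    SL k (shuffleProd k x y) (wordElt k z) = SL k (wordElt k x) (shuffleProd k y z) := by
  rw [← SL_word, ← SL_word]
  exact SL_assoc_word k _ x y z rfl

end Aux

/-- the vertical dendriform structure. -/
theorem statement16 (x y z : List V) (hx : x ≠ []) (hy : y ≠ []) (hz : z ≠ []) :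
    wedgeH k (wedgeOp k x y) (wordElt k z) = wedgeH k (wordElt k x) (shuffleProd k y z) ∧
    wedgeH k (veeOp k x y) (wordElt k z) = veeH k (wordElt k x) (wedgeOp k y z) ∧
    veeH k (shuffleProd k x y) (wordElt k z) = veeH k (wordElt k x) (veeOp k y z) := by
  obtain ⟨x', a, rfl⟩ := (List.eq_nil_or_concat' x).resolve_left hx
  obtain ⟨y', b, rfl⟩ := (List.eq_nil_or_concat' y).resolve_left hy
  obtain ⟨z', c, rfl⟩ := (List.eq_nil_or_concat' z).resolve_left hz
  simp only [wedgeH_eq, veeH_eq]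
  refine ⟨?_, ?_, ?_⟩
  · rw [wedge_snoc, WL_mul, SL_assoc, word_append k x', WL_mul]
  · rw [vee_snoc, WL_mul, wedge_snoc, EL_mul, SL_assoc]
  · rw [vee_snoc, EL_mul, word_append k z', EL_mul, SL_assoc]
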